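/- Let (X, μ) be a measure space, ε ≥ 0, and let γ, γ̂ : X → ℝ be measurable functions with γ ≥ 0 and γ̂ ≥ 0 and |γ̂(x) − γ(x)| ≤ ε·√(γ̂(x)·γ(x)) for μ-almost every x. Let u, v : X → ℂ be measurable functions such that γ̂·|u|² and γ·|v|² are integrable. Then (γ̂ − γ)·u·conj(v) is integrable and |∫ (γ̂ − γ)·u·conj(v) dμ|² ≤ ε² · (∫ γ̂·|u|² dμ) · (∫ γ·|v|² dμ). -/

import Mathlib

open MeasureTheory

/-- Cauchy-Schwarz in density form: a function whose squared norm is dominated by a product of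
two nonnegative integrable functions is integrable, and its integral obeys the same bound. -/
theorem integrable_and_norm_integral_sq_le_of_norm_sq_le_mul {X E : Type*} [MeasurableSpace X]
    [NormedAddCommGroup E] [NormedSpace ℝ E] {μ : Measure X} {f : X → E} {a b : X → ℝ}
    (hf : AEStronglyMeasurable f μ) (ha : Integrable a μ) (hb : Integrable b μ)
    (ha0 : ∀ᵐ x ∂μ, 0 ≤ a x) (hb0 : ∀ᵐ x ∂μ, 0 ≤ b x)
    (hfab : ∀ᵐ x ∂μ, ‖f x‖ ^ 2 ≤ a x * b x) :
    Integrable f μ ∧ ‖∫ x, f x ∂μ‖ ^ 2 ≤ (∫ x, a x ∂μ) * ∫ x, b x ∂μ := by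
  have hfi : Integrable f μ := by
    refine (ha.add hb).mono' hf ?_
    filter_upwards [ha0, hb0, hfab] with x h₁ h₂ h₃
    simp only [Pi.add_apply]
    nlinarith [mul_nonneg h₁ h₂]
  refine ⟨hfi, ?_⟩
  have hquad (t : ℝ) : 0 ≤ (∫ x, a x ∂μ) * (t * t) + (-2 * ∫ x, ‖f x‖ ∂μ) * t
      + ∫ x, b x ∂μ := by
    have hint : ∫ x, (a x * (t * t) + (-2 * ‖f x‖) * t + b x) ∂μ
        = (∫ x, a x ∂μ) * (t * t) + (-2 * ∫ x, ‖f x‖ ∂μ) * t + ∫ x, b x ∂μ := by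
      have hn : Integrable (fun x => (-2 * ‖f x‖) * t) μ := (hfi.norm.const_mul _).mul_const _
      have hs : Integrable (fun x => a x * (t * t) + (-2 * ‖f x‖) * t) μ :=
        (ha.mul_const _).add hn
      rw [integral_add hs hb, integral_add (ha.mul_const _) hn,
        integral_mul_const, integral_mul_const, integral_const_mul]
    rw [← hint]
    refine integral_nonneg_of_ae ?_
    filter_upwards [ha0, hb0, hfab] with x h₁ h₂ h₃
    simp only [Pi.zero_apply]
    rcases h₁.eq_or_lt with h | h
    · have hz : ‖f x‖ = 0 := by
        rw [← h, zero_mul] at h₃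
        exact pow_eq_zero_iff two_ne_zero |>.1 (le_antisymm h₃ (sq_nonneg _))
      simp [← h, hz, h₂]
    · refine nonneg_of_mul_nonneg_right ?_ h
      nlinarith [sq_nonneg (a x * t - ‖f x‖)]
  have hdisc := discrim_le_zero hquad
  rw [discrim] at hdisc
  calc ‖∫ x, f x ∂μ‖ ^ 2 ≤ (∫ x, ‖f x‖ ∂μ) ^ 2 := by
        gcongr
        exact norm_integral_le_integral_norm f
    _ ≤ (∫ x, a x ∂μ) * ∫ x, b x ∂μ := by linarith

theorem stmt19 {X : Type*} [MeasurableSpace X] (μ : Measure X)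
    (ε : ℝ) (hε : 0 ≤ ε)
    (γ γhat : X → ℝ) (hγ : Measurable γ) (hγhat : Measurable γhat)
    (hγ0 : ∀ᵐ x ∂μ, 0 ≤ γ x) (hγhat0 : ∀ᵐ x ∂μ, 0 ≤ γhat x)
    (hclose : ∀ᵐ x ∂μ, |γhat x - γ x| ≤ ε * Real.sqrt (γhat x * γ x))
    (u v : X → ℂ) (hu : Measurable u) (hv : Measurable v)
    (hui : Integrable (fun x => γhat x * ‖u x‖^2) μ)
    (hvi : Integrable (fun x => γ x * ‖v x‖^2) μ) :
    Integrable (fun x => ((γhat x - γ x : ℝ) : ℂ) * u x * (starRingEnd ℂ) (v x)) μ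
      ∧ ‖∫ x, ((γhat x - γ x : ℝ) : ℂ) * u x * (starRingEnd ℂ) (v x) ∂μ‖^2
        ≤ ε^2 * (∫ x, γhat x * ‖u x‖^2 ∂μ) * (∫ x, γ x * ‖v x‖^2 ∂μ) := by
  rw [← integral_const_mul (ε ^ 2)]
  refine integrable_and_norm_integral_sq_le_of_norm_sq_le_mul ?_
    (hui.const_mul _) hvi ?_ ?_ ?_
  · have hconj : Measurable fun x => (starRingEnd ℂ) (v x) :=
      Complex.continuous_conj.measurable.comp hv
    exact ((Complex.measurable_ofReal.comp (hγhat.sub hγ)).mul hu |>.mul hconj).aestronglyMeasurable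
  · filter_upwards [hγhat0] with x hx
    positivity
  · filter_upwards [hγ0] with x hx
    positivity
  · filter_upwards [hγ0, hγhat0, hclose] with x h₁ h₂ h₃
    have hsq : |γhat x - γ x| ^ 2 ≤ ε ^ 2 * (γhat x * γ x) := by
      rw [← Real.sq_sqrt (mul_nonneg h₂ h₁), ← mul_pow]
      gcongr
    rw [norm_mul, norm_mul, RCLike.norm_conj, Complex.norm_real, Real.norm_eq_abs]
    calc (|γhat x - γ x| * ‖u x‖ * ‖v x‖) ^ 2
        = |γhat x - γ x| ^ 2 * (‖u x‖ ^ 2 * ‖v x‖ ^ 2) := by ring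
      _ ≤ ε ^ 2 * (γhat x * γ x) * (‖u x‖ ^ 2 * ‖v x‖ ^ 2) := by gcongr
      _ = ε ^ 2 * (γhat x * ‖u x‖ ^ 2) * (γ x * ‖v x‖ ^ 2) := by ring
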